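/- arXiv:math/0111104 — 7 statements merged into one kernel-verified Lean document; each statement's English description precedes it below -/
import Mathlib

section
/- Let T > 0 and let γ = (x, y) : ℝ → ℝ² be a C² curve that is T-periodic (γ(t + T) = γ(t) for all t), has nowhere-vanishing derivative (x'(t)² + y'(t)² ≠ 0 for all t), and is injective on the interval [0, T). Then the turning integral I(γ) = ∫_{0}^{T} (y'(t)·x''(t) − x'(t)·y''(t))/(x'(t)² + y'(t)²) dt equals 2π or −2π. -/
open Complex in
theorem sub_eq_sub_of_exp_eq_const_mul_exp {u v : ℝ → ℂ} {a b : ℝ} (hab : a ≤ b)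
    (hu : ContinuousOn u (Set.Icc a b)) (hv : ContinuousOn v (Set.Icc a b)) (c : ℂ)
    (h : ∀ t ∈ Set.Icc a b, exp (u t) = c * exp (v t)) : u b - u a = v b - v a := by
  have := (isPreconnected_iff_preconnectedSpace.mp (isPreconnected_Icc (a := a) (b := b)))
  have hexp (t : Set.Icc a b) : exp (u t - v t) = c := by
    rw [exp_sub, h t t.2, mul_div_cancel_right₀ _ (exp_ne_zero _)]
  have hcont : Continuous fun t : Set.Icc a b ↦ u t - v t :=
    (hu.sub hv).comp_continuous continuous_subtype_val Subtype.prop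
  have := isCoveringMap_exp.const_of_comp hcont
    (fun s t ↦ Subtype.ext ((hexp s).trans (hexp t).symm))
    ⟨b, Set.right_mem_Icc.2 hab⟩ ⟨a, Set.left_mem_Icc.2 hab⟩
  linear_combination this

theorem exists_continuous_log_on_strip {h : ℝ × ℝ → ℂ} (hh : Continuous h) {T : ℝ} (hT : 0 ≤ T)
    (h0 : ∀ s, ∀ d ∈ Set.Icc 0 T, h (s, d) ≠ 0) :
    ∃ L : ℝ × ℝ → ℂ, Continuous L ∧ ∀ s, ∀ d ∈ Set.Icc 0 T, Complex.exp (L (s, d)) = h (s, d) := by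
  let g : C(ℝ × ℝ, ℂ) := ⟨fun p ↦ h (p.1, Set.projIcc 0 T hT p.2), by fun_prop⟩
  have hg (p : ℝ × ℝ) : g p ≠ 0 := h0 _ _ (Set.projIcc 0 T hT p.2).2
  obtain ⟨L, ⟨-, hL⟩, -⟩ := Complex.isCoveringMapOn_exp.existsUnique_continuousMap_lifts g
    (Complex.exp_log (hg 0)) hg
  refine ⟨L, L.continuous, fun s d hd ↦ ?_⟩
  simpa [g, Set.projIcc_of_mem hT hd] using congrFun hL (s, d)

/-- The average of `v` over the segment from `s` to `s + d`. -/
noncomputable def segmentAverage (v : ℝ → ℂ) (p : ℝ × ℝ) : ℂ :=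
  ∫ u in (0 : ℝ)..1, v (p.1 + u * p.2)

theorem continuous_segmentAverage {v : ℝ → ℂ} (hv : Continuous v) :
    Continuous (segmentAverage v) :=
  intervalIntegral.continuous_parametric_intervalIntegral_of_continuous' (by fun_prop) 0 1

theorem segmentAverage_zero (v : ℝ → ℂ) (s : ℝ) : segmentAverage v (s, 0) = v s := by
  simp [segmentAverage]

theorem mul_segmentAverage {γ v : ℝ → ℂ} (hγ : ∀ t, HasDerivAt γ (v t) t) (hv : Continuous v)
    (s d : ℝ) : d * segmentAverage v (s, d) = γ (s + d) - γ s := by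
  have := intervalIntegral.integral_unitInterval_deriv_eq_sub (𝕜 := ℝ) (f := γ) (f' := v)
    (z₀ := s) (z₁ := d)
    (by fun_prop) fun t _ ↦ hγ _
  simpa [segmentAverage] using this

/-- For a `T`-periodic curve with derivative `v`, a continuous function on the strip `0 ≤ d ≤ T`
that is a positive multiple of the secant from `s` to `s + d` for `0 < d < T`. -/
noncomputable def secantField (v : ℝ → ℂ) (T : ℝ) (p : ℝ × ℝ) : ℂ :=
  segmentAverage v p - segmentAverage v (p.1 + p.2, T - p.2)

section secantField

variable {γ v : ℝ → ℂ} {T : ℝ}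

theorem continuous_secantField (hv : Continuous v) : Continuous (secantField v T) :=
  (continuous_segmentAverage hv).sub ((continuous_segmentAverage hv).comp (by fun_prop))

theorem mul_secantField (hγ : ∀ t, HasDerivAt γ (v t) t) (hv : Continuous v)
    (hper : Function.Periodic γ T) (s d : ℝ) :
    (d * (T - d) : ℝ) * secantField v T (s, d) = T * (γ (s + d) - γ s) := by
  have h1 := mul_segmentAverage hγ hv s d
  have h2 := mul_segmentAverage hγ hv (s + d) (T - d)
  rw [show s + d + (T - d) = s + T by ring, hper] at h2
  simp only [secantField]
  push_cast at h2 ⊢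
  linear_combination (T - d : ℂ) * h1 - d * h2

theorem segmentAverage_period (hγ : ∀ t, HasDerivAt γ (v t) t) (hv : Continuous v)
    (hper : Function.Periodic γ T) (hT : T ≠ 0) (s : ℝ) : segmentAverage v (s, T) = 0 := by
  have h := mul_segmentAverage hγ hv s T
  rw [hper, sub_self] at h
  exact (mul_eq_zero.1 h).resolve_left (by exact_mod_cast hT)

theorem secantField_zero (hγ : ∀ t, HasDerivAt γ (v t) t) (hv : Continuous v)
    (hper : Function.Periodic γ T) (hT : T ≠ 0) (s : ℝ) : secantField v T (s, 0) = v s := by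
  simp [secantField, segmentAverage_zero, segmentAverage_period hγ hv hper hT]

theorem secantField_antisymm (hγ : ∀ t, HasDerivAt γ (v t) t) (hper : Function.Periodic γ T)
    (s d : ℝ) : secantField v T (s + d, T - d) = -secantField v T (s, d) := by
  have hvper : Function.Periodic v T := fun t ↦ by
    refine ((hγ (t + T)).comp_add_const t T).unique ?_
    simpa only [funext hper] using hγ t
  have : segmentAverage v (s + T, d) = segmentAverage v (s, d) := by
    simp only [segmentAverage]
    congr! 2 with u
    rw [← hvper (s + u * d)]
    ring_nf
  simp [secantField, this]

theorem secantField_period (hγ : ∀ t, HasDerivAt γ (v t) t) (hv : Continuous v)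
    (hper : Function.Periodic γ T) (hT : T ≠ 0) (s : ℝ) : secantField v T (s, T) = -v s := by
  have := secantField_antisymm hγ hper s 0
  simpa [secantField_zero hγ hv hper hT] using this

theorem secantField_ne_zero (hγ : ∀ t, HasDerivAt γ (v t) t) (hv : Continuous v)
    (hper : Function.Periodic γ T) (hT : 0 < T) (hv0 : ∀ t, v t ≠ 0)
    (hinj : ∀ s d, 0 < d → d < T → γ (s + d) ≠ γ s) (s d : ℝ) (hd : d ∈ Set.Icc 0 T) :
    secantField v T (s, d) ≠ 0 := by
  rcases hd.1.eq_or_lt with rfl | h0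
  · rw [secantField_zero hγ hv hper hT.ne']; exact hv0 s
  rcases hd.2.eq_or_lt with rfl | h1
  · rw [secantField_period hγ hv hper hT.ne']; exact neg_ne_zero.2 (hv0 s)
  refine right_ne_zero_of_mul (a := ((d * (T - d) : ℝ) : ℂ)) ?_
  rw [mul_secantField hγ hv hper]
  exact mul_ne_zero (by exact_mod_cast hT.ne') (sub_ne_zero.2 (hinj s d h0 h1))

theorem secantField_im_nonneg (hγ : ∀ t, HasDerivAt γ (v t) t) (hv : Continuous v)
    (hper : Function.Periodic γ T) (hT : 0 < T) {s : ℝ} (hmin : ∀ t, (γ s).im ≤ (γ t).im)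
    (hs : (v s).im = 0) (d : ℝ) (hd : d ∈ Set.Icc 0 T) : 0 ≤ (secantField v T (s, d)).im := by
  rcases hd.1.eq_or_lt with rfl | h0
  · rw [secantField_zero hγ hv hper hT.ne', hs]
  rcases hd.2.eq_or_lt with rfl | h1
  · rw [secantField_period hγ hv hper hT.ne', Complex.neg_im, hs, neg_zero]
  have h := congrArg Complex.im (mul_secantField hγ hv hper s d)
  rw [Complex.im_ofReal_mul, Complex.im_ofReal_mul, Complex.sub_im] at h
  have hpos : 0 < d * (T - d) := mul_pos h0 (sub_pos.2 h1)
  refine nonneg_of_mul_nonneg_right (h ▸ ?_) hpos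
  exact mul_nonneg hT.le (sub_nonneg.2 (hmin _))

end secantField

theorem eq_mul_exp_integral_div {v w : ℝ → ℂ} (hv : ∀ t, HasDerivAt v (w t) t)
    (hw : Continuous w) (hv0 : ∀ t, v t ≠ 0) (a s : ℝ) :
    v s = v a * Complex.exp (∫ t in a..s, w t / v t) := by
  have hvc : Continuous v := continuous_iff_continuousAt.2 fun t ↦ (hv t).continuousAt
  have hM (s : ℝ) : HasDerivAt (fun s ↦ ∫ t in a..s, w t / v t) (w s / v s) s :=
    (hw.div hvc hv0).integral_hasStrictDerivAt a s |>.hasDerivAt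
  have hd (s : ℝ) :
      HasDerivAt (fun s ↦ v s * Complex.exp (-∫ t in a..s, w t / v t)) 0 s := by
    refine ((hv s).mul (hM s).fun_neg.cexp).congr_deriv ?_
    have := hv0 s
    field_simp
    ring
  have h := is_const_of_deriv_eq_zero (fun s ↦ (hd s).differentiableAt) (fun s ↦ (hd s).deriv) s a
  simp only [intervalIntegral.integral_same, neg_zero, Complex.exp_zero, mul_one] at h
  rw [← h, mul_assoc, ← Complex.exp_add, neg_add_cancel, Complex.exp_zero, mul_one]

open Complex in
theorem log_I_mul_sub_log_neg_I_mul {r : ℝ} (hr : r ≠ 0) :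
    log (I * r) - log (-I * r) = Real.pi * I ∨ log (I * r) - log (-I * r) = -(Real.pi * I) := by
  have key {r : ℝ} (hr : 0 < r) : log (I * r) - log (-I * r) = Real.pi * I := by
    rw [log_mul_ofReal r hr _ I_ne_zero, log_mul_ofReal r hr _ (neg_ne_zero.2 I_ne_zero), log_I,
      log_neg_I]
    ring
  rcases hr.lt_or_gt with h | h
  · right
    have := key (neg_pos.2 h)
    push_cast at this
    simp only [mul_neg, neg_mul, neg_neg] at this ⊢
    rw [← this]; ring
  · exact .inl (key h)

open Complex in
theorem integral_logDeriv_tangent_of_simple_closed_curve {γ v w : ℝ → ℂ} {T : ℝ} (hT : 0 < T)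
    (hγ : ∀ t, HasDerivAt γ (v t) t) (hv : ∀ t, HasDerivAt v (w t) t) (hw : Continuous w)
    (hper : Function.Periodic γ T) (hv0 : ∀ t, v t ≠ 0)
    (hinj : ∀ s d, 0 < d → d < T → γ (s + d) ≠ γ s) {a : ℝ} (hmin : ∀ t, (γ a).im ≤ (γ t).im) :
    ∫ t in a..a + T, w t / v t = 2 * Real.pi * I ∨
      ∫ t in a..a + T, w t / v t = -(2 * Real.pi * I) := by
  have hvc : Continuous v := continuous_iff_continuousAt.2 fun t ↦ (hv t).continuousAt
  have hne := secantField_ne_zero hγ hvc hper hT hv0 hinj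
  have him : (v a).im = 0 := by
    have hd : HasDerivAt (fun t ↦ (γ t).im) (v a).im a := imCLM.hasFDerivAt.comp_hasDerivAt a (hγ a)
    exact IsLocalMin.hasDerivAt_eq_zero (.of_forall hmin) hd
  obtain ⟨L, hLc, hL⟩ := exists_continuous_log_on_strip (continuous_secantField hvc) hT.le hne
  have hfield : Continuous fun d ↦ secantField v T (a, d) :=
    (continuous_secantField hvc).comp (by fun_prop)
  have slit (d : ℝ) (hd : d ∈ Set.Icc 0 T) : -I * secantField v T (a, d) ∈ slitPlane := by
    have h0 := secantField_im_nonneg hγ hvc hper hT hmin him d hd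
    rcases h0.eq_or_lt with h | h
    · refine .inr ?_
      have : (secantField v T (a, d)).re ≠ 0 := fun hre ↦ hne a d hd (Complex.ext hre h.symm)
      simpa using this
    · exact .inl (by simpa using h)
  have bottom : L (a, T) - L (a, 0) = log (I * v a) - log (-I * v a) := by
    have := sub_eq_sub_of_exp_eq_const_mul_exp (u := fun d ↦ L (a, d))
      (v := fun d ↦ log (-I * secantField v T (a, d))) hT.le
      (by fun_prop) ((hfield.const_mul _).continuousOn.clog slit) I fun d hd ↦ by
        rw [hL a d hd, exp_log (slitPlane_ne_zero (slit d hd)), ← mul_assoc]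
        simp
    simpa [secantField_zero hγ hvc hper hT.ne', secantField_period hγ hvc hper hT.ne'] using this
  have side : L (a + T, 0) - L (a, T) = L (a, T) - L (a, 0) := by
    have := sub_eq_sub_of_exp_eq_const_mul_exp (u := fun d ↦ L (a + d, T - d))
      (v := fun d ↦ L (a, d)) hT.le (by fun_prop) (by fun_prop) (-1) fun d hd ↦ by
        rw [hL a d hd, hL _ _ ⟨sub_nonneg.2 hd.2, sub_le_self _ hd.1⟩,
          secantField_antisymm hγ hper, neg_one_mul]
    simpa using this
  have diag : L (a + T, 0) - L (a, 0) = ∫ t in a..a + T, w t / v t := by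
    have hM : Continuous fun s ↦ ∫ t in a..s, w t / v t :=
      intervalIntegral.continuous_primitive (hw.div hvc hv0).intervalIntegrable a
    have := sub_eq_sub_of_exp_eq_const_mul_exp (u := fun s ↦ L (s, 0))
      (v := fun s ↦ ∫ t in a..s, w t / v t) (a := a) (b := a + T) (by linarith) (by fun_prop)
      hM.continuousOn (v a) fun s _ ↦ by
        rw [hL s 0 ⟨le_rfl, hT.le⟩, secantField_zero hγ hvc hper hT.ne',
          ← eq_mul_exp_integral_div hv hw hv0]
    simpa using this
  have hva : v a = ((v a).re : ℂ) := Complex.ext rfl (by simp [him])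
  have hre : (v a).re ≠ 0 := fun h ↦ hv0 a (by rw [hva, h, ofReal_zero])
  rw [hva] at bottom
  rcases log_I_mul_sub_log_neg_I_mul hre with h | h
  · left; linear_combination -diag + side + 2 * bottom + 2 * h
  · right; linear_combination -diag + side + 2 * bottom + 2 * h

theorem ne_of_periodic_of_injOn_Ico {α : Type*} {f : ℝ → α} {T : ℝ} (hT : 0 < T)
    (hper : Function.Periodic f T) (hinj : Set.InjOn f (Set.Ico 0 T)) (s d : ℝ) (h0 : 0 < d)
    (h1 : d < T) : f (s + d) ≠ f s := by
  intro h
  have hmem (t : ℝ) : toIcoMod hT 0 t ∈ Set.Ico 0 T := by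
    simpa using toIcoMod_mem_Ico hT 0 t
  have hf (t : ℝ) : f (toIcoMod hT 0 t) = f t := hper.sub_zsmul_eq _
  have := hinj (hmem (s + d)) (hmem s) (by rw [hf, hf, h])
  obtain ⟨n, hn⟩ := (toIcoMod_eq_toIcoMod hT).1 this
  simp only [zsmul_eq_mul] at hn
  have h2 : (-1 : ℝ) < n := by nlinarith
  have h3 : (n : ℝ) < 0 := by nlinarith
  norm_cast at h2 h3
  lia

/-- For a C² curve `γ = (x, y) : ℝ → ℝ²` that is `T`-periodic (`T > 0`),
regular (`x'² + y'² ≠ 0` everywhere), and simple (injective on `[0, T)`), the turning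
integral `I(γ) = ∫₀ᵀ (y'·x'' − x'·y'')/(x'² + y'²) dt` equals `2π` or `−2π`. -/
theorem turning_integral_of_simple_closed_curve
    (T : ℝ) (hT : 0 < T) (x y : ℝ → ℝ)
    (hx : ContDiff ℝ 2 x) (hy : ContDiff ℝ 2 y)
    (hper : ∀ t : ℝ, x (t + T) = x t ∧ y (t + T) = y t)
    (hreg : ∀ t : ℝ, (deriv x t) ^ 2 + (deriv y t) ^ 2 ≠ 0)
    (hinj : Set.InjOn (fun t => (x t, y t)) (Set.Ico 0 T)) :
    (∫ t in (0:ℝ)..T,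
        (deriv y t * deriv (deriv x) t - deriv x t * deriv (deriv y) t) /
          ((deriv x t) ^ 2 + (deriv y t) ^ 2)) = 2 * Real.pi ∨
    (∫ t in (0:ℝ)..T,
        (deriv y t * deriv (deriv x) t - deriv x t * deriv (deriv y) t) /
          ((deriv x t) ^ 2 + (deriv y t) ^ 2)) = -(2 * Real.pi) := by
  let γ (t : ℝ) : ℂ := ⟨x t, y t⟩
  let v (t : ℝ) : ℂ := ⟨deriv x t, deriv y t⟩
  let w (t : ℝ) : ℂ := ⟨deriv (deriv x) t, deriv (deriv y) t⟩
  have mk_hasDerivAt {f g : ℝ → ℝ} {f' g' t : ℝ} (hf : HasDerivAt f f' t)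
      (hg : HasDerivAt g g' t) : HasDerivAt (fun t ↦ (⟨f t, g t⟩ : ℂ)) ⟨f', g'⟩ t := by
    simp only [Complex.mk_eq_add_mul_I]
    exact hf.ofReal_comp.add (hg.ofReal_comp.mul_const _)
  have hx' : ContDiff ℝ 1 (deriv x) := hx.deriv'
  have hy' : ContDiff ℝ 1 (deriv y) := hy.deriv'
  have hγ (t : ℝ) : HasDerivAt γ (v t) t :=
    mk_hasDerivAt (hx.differentiable (by norm_num) t).hasDerivAt
      (hy.differentiable (by norm_num) t).hasDerivAt
  have hv (t : ℝ) : HasDerivAt v (w t) t :=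
    mk_hasDerivAt (hx'.differentiable (by norm_num) t).hasDerivAt
      (hy'.differentiable (by norm_num) t).hasDerivAt
  have hw : Continuous w := by
    have h1 := hx'.continuous_deriv_one
    have h2 := hy'.continuous_deriv_one
    simp only [w, Complex.mk_eq_add_mul_I]
    fun_prop
  have hv0 (t : ℝ) : v t ≠ 0 := fun h ↦ hreg t <| by
    have h1 : deriv x t = 0 := congrArg Complex.re h
    have h2 : deriv y t = 0 := congrArg Complex.im h
    simp [h1, h2]
  have hpγ : Function.Periodic γ T := fun t ↦ Complex.ext (hper t).1 (hper t).2
  have hinjγ := ne_of_periodic_of_injOn_Ico hT hpγ fun s hs t ht h ↦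
    hinj hs ht (Prod.ext (congrArg Complex.re h) (congrArg Complex.im h))
  obtain ⟨_, ⟨a, rfl⟩, ha⟩ := (Function.Periodic.compact_of_continuous (f := y)
    (fun t ↦ (hper t).2) hT.ne' hy.continuous).exists_isLeast (Set.range_nonempty y)
  have key := integral_logDeriv_tangent_of_simple_closed_curve hT hγ hv hw hpγ hv0 hinjγ (a := a)
    fun t ↦ ha ⟨t, rfl⟩
  have hvper : Function.Periodic (fun t ↦ w t / v t) T := fun t ↦ by
    have px : (fun t ↦ x (t + T)) = x := funext fun t ↦ (hper t).1
    have py : (fun t ↦ y (t + T)) = y := funext fun t ↦ (hper t).2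
    have px' : (fun t ↦ deriv x (t + T)) = deriv x := by
      funext t; rw [← deriv_comp_add_const, px]
    have py' : (fun t ↦ deriv y (t + T)) = deriv y := by
      funext t; rw [← deriv_comp_add_const, py]
    have hw' : w (t + T) = w t := by
      simp only [w]
      rw [← deriv_comp_add_const, px', ← deriv_comp_add_const, py']
    have hv' : v (t + T) = v t := Complex.ext (congrFun px' t) (congrFun py' t)
    simp only [hw', hv']
  rw [← hvper.intervalIntegral_add_eq 0 a, zero_add] at key
  have hvc : Continuous v := continuous_iff_continuousAt.2 fun t ↦ (hv t).continuousAt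
  have hint : (∫ t in (0:ℝ)..T,
        (deriv y t * deriv (deriv x) t - deriv x t * deriv (deriv y) t) /
          ((deriv x t) ^ 2 + (deriv y t) ^ 2)) = -(∫ t in (0:ℝ)..T, w t / v t).im := by
    have : ∫ t in (0 : ℝ)..T, Complex.imCLM (w t / v t) =
        Complex.imCLM (∫ t in (0 : ℝ)..T, w t / v t) :=
      Complex.imCLM.intervalIntegral_comp_comm
        ((hw.div hvc hv0).intervalIntegrable (μ := MeasureTheory.volume) 0 T)
    rw [← Complex.imCLM_apply, ← this, ← intervalIntegral.integral_neg]
    congr! 2 with t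
    simp only [w, v, Complex.imCLM_apply, Complex.div_im, Complex.normSq_mk]
    ring
  rw [hint]
  rcases key with h | h <;> rw [h]
  · right; simp
  · left; simp
end

section
/- Let T > 0 and let γ = (x, y) : ℝ → ℝ² be a C² curve that is T-periodic and regular (x'(t)² + y'(t)² ≠ 0 for all t). Then there exists an integer k ∈ ℤ such that ∫_{0}^{T} (y'(t)·x''(t) − x'(t)·y''(t))/(x'(t)² + y'(t)²) dt = 2πk. -/
/-- A loop `z` that avoids `0` has an integral of `z' / z` in `2πiℤ`. -/
theorem exists_integral_deriv_div_eq_int_mul_two_pi_I {z z' : ℝ → ℂ} {a b : ℝ}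
    (hz : ∀ t, HasDerivAt z (z' t) t) (hz' : Continuous z') (hne : ∀ t, z t ≠ 0)
    (hab : z b = z a) :
    ∃ n : ℤ, ∫ t in a..b, z' t / z t = n * (2 * Real.pi * Complex.I) := by
  have hcont : Continuous fun t => z' t / z t :=
    hz'.div (continuous_iff_continuousAt.2 fun t => (hz t).continuousAt) hne
  have hderiv : ∀ t, HasDerivAt (fun t => z t * Complex.exp (-∫ s in a..t, z' s / z s)) 0 t := by
    intro t
    refine ((hz t).mul
      (hcont.integral_hasStrictDerivAt a t).hasDerivAt.neg.cexp).congr_deriv ?_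
    have := hne t
    field_simp
    ring
  have hconst := is_const_of_deriv_eq_zero (fun t => (hderiv t).differentiableAt)
    (fun t => (hderiv t).deriv) b a
  rw [hab, intervalIntegral.integral_same] at hconst
  have hexp : Complex.exp (-∫ s in a..b, z' s / z s) = 1 := by
    simpa using mul_left_cancel₀ (hne a) hconst
  rw [Complex.exp_neg, inv_eq_one] at hexp
  exact Complex.exp_eq_one_iff.1 hexp

/-- For a C² curve `γ = (x, y) : ℝ → ℝ²` that is `T`-periodic (`T > 0`)
and regular (`x'² + y'² ≠ 0` everywhere), the turning integral
`∫₀ᵀ (y'·x'' − x'·y'')/(x'² + y'²) dt` is an integer multiple of `2π`. -/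
theorem turning_integral_eq_two_pi_mul_int
    (T : ℝ) (hT : 0 < T) (x y : ℝ → ℝ)
    (hx : ContDiff ℝ 2 x) (hy : ContDiff ℝ 2 y)
    (hper : ∀ t : ℝ, x (t + T) = x t ∧ y (t + T) = y t)
    (hreg : ∀ t : ℝ, (deriv x t) ^ 2 + (deriv y t) ^ 2 ≠ 0) :
    ∃ k : ℤ,
      (∫ t in (0:ℝ)..T,
          (deriv y t * deriv (deriv x) t - deriv x t * deriv (deriv y) t) /
            ((deriv x t) ^ 2 + (deriv y t) ^ 2)) = 2 * Real.pi * k := by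
  have hu : ContDiff ℝ 1 (deriv x) := hx.deriv'
  have hv : ContDiff ℝ 1 (deriv y) := hy.deriv'
  have hu' := hu.continuous_deriv le_rfl
  have hv' := hv.continuous_deriv le_rfl
  have hperiodic {f : ℝ → ℝ} (hf : ∀ t, f (t + T) = f t) : deriv f T = deriv f 0 := by
    simpa [funext hf] using (deriv_comp_add_const f T 0).symm
  let z : ℝ → ℂ := fun t => deriv x t + deriv y t * Complex.I
  let z' : ℝ → ℂ := fun t => deriv (deriv x) t + deriv (deriv y) t * Complex.I
  have hz (t : ℝ) : HasDerivAt z (z' t) t :=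
    (hu.differentiable one_ne_zero t).hasDerivAt.ofReal_comp.add
      ((hv.differentiable one_ne_zero t).hasDerivAt.ofReal_comp.mul_const _)
  have hz' : Continuous z' := by fun_prop
  have hnormSq (t : ℝ) : Complex.normSq (z t) = deriv x t ^ 2 + deriv y t ^ 2 :=
    Complex.normSq_add_mul_I _ _
  have hne (t : ℝ) : z t ≠ 0 := fun h => hreg t (by rw [← hnormSq, h, map_zero])
  have hloop : z T = z 0 := by
    simp only [z, hperiodic fun t => (hper t).1, hperiodic fun t => (hper t).2]
  obtain ⟨n, hn⟩ := exists_integral_deriv_div_eq_int_mul_two_pi_I hz hz' hne hloop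
  have hint : IntervalIntegrable (fun t => z' t / z t) MeasureTheory.volume 0 T :=
    (hz'.div (continuous_iff_continuousAt.2 fun t => (hz t).continuousAt)
      hne).intervalIntegrable _ _
  have him : ∫ t in (0:ℝ)..T, (z' t / z t).im = n * (2 * Real.pi) := by
    refine (Complex.imCLM.intervalIntegral_comp_comm hint).trans ?_
    rw [hn]
    simp
  refine ⟨-n, ?_⟩
  calc _ = ∫ t in (0:ℝ)..T, -(z' t / z t).im := by
        refine intervalIntegral.integral_congr fun t _ => ?_
        simp only [Complex.div_im, hnormSq]
        simp [z, z']
        ring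
    _ = _ := by
        rw [intervalIntegral.integral_neg, him]
        push_cast
        ring
end

section
/- Let H : ℝ × [0,1] → ℝ² be a C² map such that for every s ∈ [0,1] the curve γₛ := H(·, s) is 2π-periodic in the first variable and regular (∂H/∂t (t,s) ≠ 0 for all t, s). Writing γₛ = (xₛ, yₛ), the turning integral I(γₛ) = ∫_{0}^{2π} (yₛ'·xₛ'' − xₛ'·yₛ'')/(xₛ'² + yₛ'²) dt is independent of s; in particular I(γ₀) = I(γ₁). Thus I is an invariant of the regular (smooth) homotopy class of closed immersed plane curves. -/
/-- The turning integral of a closed plane curve `γ : ℝ → ℝ²` over one period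
`[0, 2π]`: `I(γ) = ∫₀^{2π} (y'·x'' − x'·y'')/(x'² + y'²) dt`. -/
noncomputable def turningIntegral (γ : ℝ → ℝ × ℝ) : ℝ :=
  ∫ t in (0:ℝ)..(2 * Real.pi),
    (deriv (fun u => (γ u).2) t * deriv (deriv (fun u => (γ u).1)) t -
        deriv (fun u => (γ u).1) t * deriv (deriv (fun u => (γ u).2)) t) /
      ((deriv (fun u => (γ u).1) t) ^ 2 + (deriv (fun u => (γ u).2) t) ^ 2)

open Set Filter Topology

/-- The derivative of the oriented angle between two plane vectors with positive inner product is
the difference of their angular speeds. -/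
lemma hasDerivAt_arctan_cross_div_dot {a b c d : ℝ → ℝ} {a' b' c' d' t : ℝ}
    (ha : HasDerivAt a a' t) (hb : HasDerivAt b b' t) (hc : HasDerivAt c c' t)
    (hd : HasDerivAt d d' t) (hpos : 0 < a t * c t + b t * d t) :
    HasDerivAt (fun t => Real.arctan ((b t * c t - a t * d t) / (a t * c t + b t * d t)))
      ((d t * c' - c t * d') / (c t ^ 2 + d t ^ 2) -
        (b t * a' - a t * b') / (a t ^ 2 + b t ^ 2)) t := by
  have h := (((hb.mul hc).sub (ha.mul hd)).div ((ha.mul hc).add (hb.mul hd)) hpos.ne').arctan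
  refine h.congr_deriv ?_
  have h₁ : a t ^ 2 + b t ^ 2 ≠ 0 := by
    intro h0
    obtain ⟨ha0, hb0⟩ : a t = 0 ∧ b t = 0 := by
      rwa [sq, sq, mul_self_add_mul_self_eq_zero] at h0
    simp [ha0, hb0] at hpos
  have h₂ : c t ^ 2 + d t ^ 2 ≠ 0 := by
    intro h0
    obtain ⟨hc0, hd0⟩ : c t = 0 ∧ d t = 0 := by
      rwa [sq, sq, mul_self_add_mul_self_eq_zero] at h0
    simp [hc0, hd0] at hpos
  have h₃ : (a t * c t + b t * d t) ^ 2 + (b t * c t - a t * d t) ^ 2 =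
      (a t ^ 2 + b t ^ 2) * (c t ^ 2 + d t ^ 2) := by ring
  have h₄ : 1 + ((b t * c t - a t * d t) / (a t * c t + b t * d t)) ^ 2 =
      (a t ^ 2 + b t ^ 2) * (c t ^ 2 + d t ^ 2) / (a t * c t + b t * d t) ^ 2 := by
    rw [← h₃, add_div, div_self (pow_ne_zero 2 hpos.ne'), div_pow]
  simp only [Pi.mul_apply, Pi.add_apply, Pi.sub_apply, Pi.div_apply]
  rw [h₄]
  have hne := hpos.ne'
  field_simp
  ring

/-- Two closed `C¹` plane curves whose inner product is pointwise positive have the same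
total angular variation. -/
lemma integral_angular_speed_eq_of_dot_pos {a b c d : ℝ → ℝ} {T : ℝ} (hT : 0 ≤ T)
    (ha : ContDiff ℝ 1 a) (hb : ContDiff ℝ 1 b) (hc : ContDiff ℝ 1 c) (hd : ContDiff ℝ 1 d)
    (haT : a T = a 0) (hbT : b T = b 0) (hcT : c T = c 0) (hdT : d T = d 0)
    (hpos : ∀ t ∈ Icc 0 T, 0 < a t * c t + b t * d t) :
    ∫ t in (0:ℝ)..T, (b t * deriv a t - a t * deriv b t) / (a t ^ 2 + b t ^ 2) =
      ∫ t in (0:ℝ)..T, (d t * deriv c t - c t * deriv d t) / (c t ^ 2 + d t ^ 2) := by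
  have key {f g : ℝ → ℝ} (hf : ContDiff ℝ 1 f) (hg : ContDiff ℝ 1 g)
      (hne : ∀ t ∈ Icc 0 T, f t ^ 2 + g t ^ 2 ≠ 0) :
      IntervalIntegrable (fun t => (g t * deriv f t - f t * deriv g t) / (f t ^ 2 + g t ^ 2))
        MeasureTheory.volume 0 T := by
    apply ContinuousOn.intervalIntegrable
    rw [uIcc_of_le hT]
    have hf₀ := hf.continuous
    have hg₀ := hg.continuous
    have hf₁ := hf.continuous_deriv_one
    have hg₁ := hg.continuous_deriv_one
    exact ContinuousOn.div (by fun_prop) (by fun_prop) hne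
  have hab := key ha hb fun t ht h0 => by
    obtain ⟨ha0, hb0⟩ : a t = 0 ∧ b t = 0 := by
      rwa [sq, sq, mul_self_add_mul_self_eq_zero] at h0
    simpa [ha0, hb0] using hpos t ht
  have hcd := key hc hd fun t ht h0 => by
    obtain ⟨hc0, hd0⟩ : c t = 0 ∧ d t = 0 := by
      rwa [sq, sq, mul_self_add_mul_self_eq_zero] at h0
    simpa [hc0, hd0] using hpos t ht
  have hderiv {f : ℝ → ℝ} (hf : ContDiff ℝ 1 f) (t : ℝ) : HasDerivAt f (deriv f t) t :=
    (hf.differentiable one_ne_zero t).hasDerivAt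
  have hFTC := intervalIntegral.integral_eq_sub_of_hasDerivAt (fun t ht =>
    hasDerivAt_arctan_cross_div_dot (hderiv ha t) (hderiv hb t) (hderiv hc t) (hderiv hd t)
      (hpos t (by rwa [uIcc_of_le hT] at ht))) (hcd.sub hab)
  rw [intervalIntegral.integral_sub hcd hab, haT, hbT, hcT, hdT, sub_self] at hFTC
  linarith

/-- The partial derivative of `H` in the first variable. -/
noncomputable def partialFst (H : ℝ × ℝ → ℝ × ℝ) (p : ℝ × ℝ) : ℝ × ℝ :=
  fderiv ℝ H p (1, 0)

lemma contDiff_partialFst {H : ℝ × ℝ → ℝ × ℝ} (hH : ContDiff ℝ 2 H) :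
    ContDiff ℝ 1 (partialFst H) :=
  (hH.fderiv_right (m := 1) (by norm_num)).clm_apply contDiff_const

lemma hasDerivAt_partialFst {H : ℝ × ℝ → ℝ × ℝ} (hH : Differentiable ℝ H) (t s : ℝ) :
    HasDerivAt (fun u => H (u, s)) (partialFst H (t, s)) t :=
  (hH (t, s)).hasFDerivAt.comp_hasDerivAt t ((hasDerivAt_id t).prodMk (hasDerivAt_const t s))

lemma turningIntegral_eq_integral_partialFst {H : ℝ × ℝ → ℝ × ℝ} (hH : Differentiable ℝ H)
    (s : ℝ) :
    turningIntegral (fun t => H (t, s)) = ∫ t in (0:ℝ)..(2 * Real.pi),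
      ((partialFst H (t, s)).2 * deriv (fun u => (partialFst H (u, s)).1) t -
        (partialFst H (t, s)).1 * deriv (fun u => (partialFst H (u, s)).2) t) /
      ((partialFst H (t, s)).1 ^ 2 + (partialFst H (t, s)).2 ^ 2) := by
  have h₁ : deriv (fun u => (H (u, s)).1) = fun t => (partialFst H (t, s)).1 :=
    funext fun t => ((ContinuousLinearMap.fst ℝ ℝ ℝ).hasFDerivAt.comp_hasDerivAt t
      (hasDerivAt_partialFst hH t s)).deriv
  have h₂ : deriv (fun u => (H (u, s)).2) = fun t => (partialFst H (t, s)).2 :=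
    funext fun t => ((ContinuousLinearMap.snd ℝ ℝ ℝ).hasFDerivAt.comp_hasDerivAt t
      (hasDerivAt_partialFst hH t s)).deriv
  simp only [turningIntegral, h₁, h₂]

/-- If `H : ℝ × [0,1] → ℝ²` is a C² regular homotopy — each curve
`γₛ = H(·, s)` is `2π`-periodic and has nowhere-vanishing `t`-derivative for
`s ∈ [0,1]` — then the turning integral `I(γₛ)` is independent of `s`; in particular
`I(γ₀) = I(γ₁)`.  Thus `I` is an invariant of the regular homotopy class. -/
theorem turning_integral_regular_homotopy_invariant
    (H : ℝ × ℝ → ℝ × ℝ) (hH : ContDiff ℝ 2 H)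
    (hper : ∀ s ∈ Set.Icc (0:ℝ) 1, ∀ t : ℝ, H (t + 2 * Real.pi, s) = H (t, s))
    (hreg : ∀ s ∈ Set.Icc (0:ℝ) 1, ∀ t : ℝ, deriv (fun u => H (u, s)) t ≠ 0) :
    (∀ s₀ ∈ Set.Icc (0:ℝ) 1, ∀ s₁ ∈ Set.Icc (0:ℝ) 1,
        turningIntegral (fun t => H (t, s₀)) = turningIntegral (fun t => H (t, s₁))) ∧
    turningIntegral (fun t => H (t, 0)) = turningIntegral (fun t => H (t, 1)) := by
  have hd : Differentiable ℝ H := hH.differentiable two_ne_zero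
  have hP := contDiff_partialFst hH
  have hPper : ∀ s ∈ Icc (0:ℝ) 1, partialFst H (2 * Real.pi, s) = partialFst H (0, s) := by
    intro s hs
    rw [← (hasDerivAt_partialFst hd (2 * Real.pi) s).deriv,
      ← (hasDerivAt_partialFst hd 0 s).deriv, ← zero_add (2 * Real.pi),
      ← deriv_comp_add_const (fun u => H (u, s))]
    simp only [hper s hs]
  have hloc : IsLocallyConstant
      (fun s : Icc (0:ℝ) 1 => turningIntegral (fun t => H (t, (s : ℝ)))) := by
    rw [IsLocallyConstant.iff_eventually_eq]
    intro s
    have hdot : ∀ᶠ r : Icc (0:ℝ) 1 in 𝓝 s, ∀ t ∈ Icc (0:ℝ) (2 * Real.pi),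
        0 < (partialFst H (t, r)).1 * (partialFst H (t, s)).1 +
          (partialFst H (t, r)).2 * (partialFst H (t, s)).2 := by
      refine isCompact_Icc.eventually_forall_of_forall_eventually fun t _ => ?_
      have hPc := hP.continuous
      have hcont : Continuous (fun z : Icc (0:ℝ) 1 × ℝ =>
          (partialFst H (z.2, z.1)).1 * (partialFst H (z.2, s)).1 +
            (partialFst H (z.2, z.1)).2 * (partialFst H (z.2, s)).2) := by fun_prop
      refine hcont.continuousAt.eventually_const_lt ?_
      have hne := hreg s s.2 t
      rw [(hasDerivAt_partialFst hd t s).deriv] at hne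
      refine lt_of_le_of_ne (add_nonneg (mul_self_nonneg _) (mul_self_nonneg _)) fun h0 => hne ?_
      rw [eq_comm, mul_self_add_mul_self_eq_zero] at h0
      exact Prod.ext h0.1 h0.2
    filter_upwards [hdot] with r hr
    have hcurve (q : ℝ) : ContDiff ℝ 1 (fun t => partialFst H (t, q)) :=
      hP.comp (contDiff_id.prodMk contDiff_const)
    rw [turningIntegral_eq_integral_partialFst hd, turningIntegral_eq_integral_partialFst hd]
    exact integral_angular_speed_eq_of_dot_pos Real.two_pi_pos.le
      (hcurve r).fst (hcurve r).snd (hcurve s).fst (hcurve s).snd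
      (congrArg Prod.fst (hPper r r.2)) (congrArg Prod.snd (hPper r r.2))
      (congrArg Prod.fst (hPper s s.2)) (congrArg Prod.snd (hPper s s.2)) hr
  have hconst : ∀ s₀ ∈ Icc (0:ℝ) 1, ∀ s₁ ∈ Icc (0:ℝ) 1,
      turningIntegral (fun t => H (t, s₀)) = turningIntegral (fun t => H (t, s₁)) :=
    fun s₀ h₀ s₁ h₁ => hloc.apply_eq_of_preconnectedSpace ⟨s₀, h₀⟩ ⟨s₁, h₁⟩
  exact ⟨hconst, hconst 0 (by simp) 1 (by simp)⟩
end

section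
/- Fix n ≥ 1 and for p ∈ ℝ^{n+1} with p ≠ 0 define the n-form ω_p by ω_p(v₁, …, vₙ) = det(M(p, v₁, …, vₙ))/‖p‖^{n+1}, where M(p, v₁, …, vₙ) is the (n+1) × (n+1) matrix with rows p, v₁, …, vₙ. Then ω is a closed n-form on ℝ^{n+1} \ {0}: the map p ↦ ω_p is differentiable away from 0, and for every p ≠ 0 and all vectors v₀, v₁, …, vₙ ∈ ℝ^{n+1}, the antisymmetrized derivative vanishes: Σ_{i=0}^{n} (−1)^i · D(p ↦ ω_p)(p)(v_i)(v₀, …, v̂_i, …, vₙ) = 0, where v̂_i means v_i is omitted. -/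
/-- The canonical `n`-form on `ℝ^{n+1} \ {0}`: at a point `p` it sends tangent
vectors `v₁, …, vₙ` to `det(p, v₁, …, vₙ) / ‖p‖^{n+1}`, the determinant of the
`(n+1) × (n+1)` matrix with rows `p, v₁, …, vₙ` divided by the `(n+1)`-st power of
the Euclidean norm `‖p‖ = √(p₀² + ⋯ + pₙ²)`. -/
noncomputable def omegaForm (n : ℕ) (p : Fin (n + 1) → ℝ)
    (v : Fin n → (Fin (n + 1) → ℝ)) : ℝ :=
  Matrix.det (Matrix.of (Fin.cons p v)) / (Real.sqrt (∑ i, p i ^ 2)) ^ (n + 1)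

theorem Matrix.det_of_cons_succAbove {n : ℕ} {R : Type*} [CommRing R]
    (A : Matrix (Fin (n + 1)) (Fin (n + 1)) R) (i : Fin (n + 1)) (q : Fin (n + 1) → R) :
    Matrix.det (Matrix.of (Fin.cons q fun j => A (i.succAbove j))) =
      (-1) ^ (i : ℕ) * (A.updateRow i q).det := by
  rw [Matrix.det_succ_row_zero, Matrix.det_succ_row _ i, Finset.mul_sum]
  refine Finset.sum_congr rfl fun j _ => ?_
  have h : (-1 : R) ^ (i : ℕ) * (-1) ^ (i : ℕ) = 1 := by
    rw [← mul_pow]; simp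
  rw [Matrix.submatrix_updateRow_succAbove, Matrix.updateRow_self, pow_add]
  change (-1) ^ (j : ℕ) * q j * (A.submatrix i.succAbove j.succAbove).det = _
  linear_combination (-(-1) ^ (j : ℕ) * q j * (A.submatrix i.succAbove j.succAbove).det) * h

/-- Cramer's rule by rows: `q` scaled by `det A` is a combination of the rows of `A`. -/
theorem Matrix.sum_det_updateRow_mul {m R : Type*} [Fintype m] [DecidableEq m] [CommRing R]
    (A : Matrix m m R) (q : m → R) (k : m) :
    ∑ i, (A.updateRow i q).det * A i k = A.det * q k := by
  have h := congrFun (Matrix.mulVec_cramer A.transpose q) k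
  simpa [Matrix.mulVec, dotProduct, Matrix.cramer_transpose_apply, Matrix.det_transpose,
    mul_comm] using h

theorem sum_sq_pos {m : Type*} [Fintype m] {p : m → ℝ} (hp : p ≠ 0) : 0 < ∑ i, p i ^ 2 := by
  obtain ⟨i, hi⟩ := Function.ne_iff.mp hp
  exact Finset.sum_pos' (fun j _ => sq_nonneg _) ⟨i, Finset.mem_univ i, sq_pos_of_ne_zero hi⟩

theorem hasFDerivAt_det_of_cons {n : ℕ} (w : Fin n → (Fin (n + 1) → ℝ)) (p : Fin (n + 1) → ℝ) :
    ∃ L : (Fin (n + 1) → ℝ) →L[ℝ] ℝ,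
      (∀ q, L q = Matrix.det (Matrix.of (Fin.cons q w))) ∧
      HasFDerivAt (fun q => Matrix.det (Matrix.of (Fin.cons q w))) L p := by
  let f : (Fin (n + 1) → ℝ) →ₗ[ℝ] ℝ :=
    { toFun := fun q => Matrix.det (Matrix.of (Fin.cons q w))
      map_add' := fun x y =>
        (Matrix.detRowAlternating (R := ℝ) (n := Fin (n + 1))).toMultilinearMap.cons_add w x y
      map_smul' := fun c x =>
        (Matrix.detRowAlternating (R := ℝ) (n := Fin (n + 1))).toMultilinearMap.cons_smul w c x }
  exact ⟨f.toContinuousLinearMap, fun q => rfl, f.toContinuousLinearMap.hasFDerivAt⟩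

theorem hasFDerivAt_sqrt_sum_sq {m : Type*} [Fintype m] {p : m → ℝ} (hp : p ≠ 0) :
    HasFDerivAt (fun q : m → ℝ => √(∑ i, q i ^ 2))
      ((√(∑ i, p i ^ 2))⁻¹ • ∑ i, p i • ContinuousLinearMap.proj (R := ℝ) (φ := fun _ => ℝ) i)
      p := by
  have h : HasFDerivAt (fun q : m → ℝ => ∑ i, q i ^ 2)
      (∑ i, (2 * p i) • ContinuousLinearMap.proj (R := ℝ) (φ := fun _ => ℝ) i) p := by
    refine HasFDerivAt.fun_sum fun i _ => ?_
    simpa using (hasFDerivAt_apply (𝕜 := ℝ) (F' := fun _ : m => ℝ) i p).pow 2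
  refine (h.sqrt (sum_sq_pos hp).ne').congr_fderiv ?_
  ext v
  simp only [smul_apply, sum_apply, ContinuousLinearMap.proj_apply, smul_eq_mul,
    mul_assoc, ← Finset.mul_sum]
  ring

theorem hasFDerivAt_omegaForm {n : ℕ} (w : Fin n → (Fin (n + 1) → ℝ)) {p : Fin (n + 1) → ℝ}
    (hp : p ≠ 0) :
    ∃ L : (Fin (n + 1) → ℝ) →L[ℝ] ℝ,
      (∀ u, L u = (Matrix.det (Matrix.of (Fin.cons u w)) * ∑ k, p k ^ 2 -
        (n + 1) * Matrix.det (Matrix.of (Fin.cons p w)) * ∑ k, p k * u k) /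
          √(∑ k, p k ^ 2) ^ (n + 3)) ∧
      HasFDerivAt (fun q => omegaForm n q w) L p := by
  obtain ⟨D, hD, hD'⟩ := hasFDerivAt_det_of_cons w p
  have hr : √(∑ k, p k ^ 2) ≠ 0 := (Real.sqrt_pos.2 (sum_sq_pos hp)).ne'
  have hsq : √(∑ k, p k ^ 2) ^ 2 = ∑ k, p k ^ 2 := Real.sq_sqrt (sum_sq_pos hp).le
  have h := hD'.mul ((hasDerivAt_inv (pow_ne_zero (n + 1) hr)).comp_hasFDerivAt p
    ((hasFDerivAt_sqrt_sum_sq hp).pow (n + 1)))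
  refine ⟨_, fun u => ?_, h⟩
  simp only [add_apply, smul_apply, sum_apply, ContinuousLinearMap.proj_apply, smul_eq_mul, hD,
    Function.comp_apply, nsmul_eq_mul, Nat.add_sub_cancel]
  generalize √(∑ k, p k ^ 2) = r at hr hsq ⊢
  rw [← hsq]
  push_cast
  field_simp
  ring

theorem sum_fderiv_omegaForm {n : ℕ} (A : Matrix (Fin (n + 1)) (Fin (n + 1)) ℝ)
    {p : Fin (n + 1) → ℝ} (hp : p ≠ 0) :
    ∑ i : Fin (n + 1), (-1 : ℝ) ^ (i : ℕ) *
      fderiv ℝ (fun q => omegaForm n q (fun j => A (i.succAbove j))) p (A i) = 0 := by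
  have key (i : Fin (n + 1)) : (-1 : ℝ) ^ (i : ℕ) *
      fderiv ℝ (fun q => omegaForm n q (fun j => A (i.succAbove j))) p (A i) =
      (A.det * ∑ k, p k ^ 2 -
        (n + 1) * ∑ k, p k * ((A.updateRow i p).det * A i k)) /
          √(∑ k, p k ^ 2) ^ (n + 3) := by
    obtain ⟨L, hL, hL'⟩ := hasFDerivAt_omegaForm (fun j => A (i.succAbove j)) hp
    have hs : (-1 : ℝ) ^ (i : ℕ) * (-1) ^ (i : ℕ) = 1 := by
      rw [← mul_pow]; simp
    have hv : A.updateRow i (A i) = A := A.updateRow_eq_self i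
    simp only [hL'.fderiv, hL, Matrix.det_of_cons_succAbove, hv, mul_left_comm (p _),
      ← Finset.mul_sum]
    linear_combination ((A.det * ∑ k, p k ^ 2 -
      (n + 1) * ((A.updateRow i p).det * ∑ k, p k * A i k)) /
        √(∑ k, p k ^ 2) ^ (n + 3)) * hs
  have cramer : ∑ i, ∑ k, p k * ((A.updateRow i p).det * A i k) =
      A.det * ∑ k, p k ^ 2 := by
    rw [Finset.sum_comm, Finset.mul_sum]
    refine Finset.sum_congr rfl fun k _ => ?_
    rw [← Finset.mul_sum, Matrix.sum_det_updateRow_mul]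
    ring
  simp only [key, ← Finset.sum_div, Finset.sum_sub_distrib,
    ← Finset.mul_sum (Finset.univ (α := Fin (n + 1))) _ ((n : ℝ) + 1), cramer]
  have h : ∑ _i : Fin (n + 1), A.det * ∑ k, p k ^ 2 = (n + 1) * (A.det * ∑ k, p k ^ 2) := by
    simp
  rw [h, sub_self, zero_div]

/-- the canonical `n`-form is closed on `ℝ^{n+1} \ {0}`: away from the
origin the map `p ↦ ω_p` is differentiable (against each fixed tuple of tangent
vectors), and its exterior derivative
`dω(p)(v₀, …, vₙ) = Σᵢ (−1)ⁱ D(ω_·)(p)(vᵢ)(v₀, …, v̂ᵢ, …, vₙ)` vanishes. -/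
theorem omegaForm_closed (n : ℕ) (hn : 1 ≤ n) (p : Fin (n + 1) → ℝ) (hp : p ≠ 0) :
    (∀ w : Fin n → (Fin (n + 1) → ℝ),
      DifferentiableAt ℝ (fun q => omegaForm n q w) p) ∧
    ∀ v : Fin (n + 1) → (Fin (n + 1) → ℝ),
      ∑ i : Fin (n + 1), (-1 : ℝ) ^ (i : ℕ) *
        fderiv ℝ (fun q => omegaForm n q (fun j => v (i.succAbove j))) p (v i) = 0 := by
  exact ⟨fun w => (hasFDerivAt_omegaForm w hp).choose_spec.2.differentiableAt,
    fun v => sum_fderiv_omegaForm (Matrix.of v) hp⟩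
end

section
/- For p ∈ ℝ³ with p ≠ 0, let ω_p be the alternating bilinear form ω_p(v, w) = det(M(p, v, w))/‖p‖³, where M(p, v, w) is the 3 × 3 matrix with rows p, v, w. There is no differentiable map η : ℝ³ \ {0} → (ℝ³ →L[ℝ] ℝ) such that for all p ≠ 0 and all v, w ∈ ℝ³, Dη(p)(v)(w) − Dη(p)(w)(v) = ω_p(v, w); i.e., the closed 2-form ω on ℝ³ \ {0} is not exact and hence defines a nonzero class in H²(ℝ³ \ {0}; ℝ). -/
open MeasureTheory

/-- The unit vector of `ℝ³` with polar angle `a.1` and azimuth `a.2`. -/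
noncomputable def sphericalPoint (a : ℝ × ℝ) : Fin 3 → ℝ :=
  ![Real.sin a.1 * Real.cos a.2, Real.sin a.1 * Real.sin a.2, Real.cos a.1]

/-- The derivative of `sphericalPoint` in the polar angle. -/
noncomputable def sphericalPolar (a : ℝ × ℝ) : Fin 3 → ℝ :=
  ![Real.cos a.1 * Real.cos a.2, Real.cos a.1 * Real.sin a.2, -Real.sin a.1]

/-- The derivative of `sphericalPoint` in the azimuth. -/
noncomputable def sphericalAzimuth (a : ℝ × ℝ) : Fin 3 → ℝ :=
  ![-(Real.sin a.1 * Real.sin a.2), Real.sin a.1 * Real.cos a.2, 0]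

/-- The mixed second derivative of `sphericalPoint`. -/
noncomputable def sphericalMixed (a : ℝ × ℝ) : Fin 3 → ℝ :=
  ![-(Real.cos a.1 * Real.sin a.2), Real.cos a.1 * Real.cos a.2, 0]

theorem sum_sq_sphericalPoint (a : ℝ × ℝ) : ∑ i, sphericalPoint a i ^ 2 = 1 := by
  simp only [sphericalPoint, Fin.sum_univ_three, Matrix.cons_val]
  linear_combination Real.sin a.1 ^ 2 * Real.sin_sq_add_cos_sq a.2 + Real.sin_sq_add_cos_sq a.1

theorem sphericalPoint_ne_zero (a : ℝ × ℝ) : sphericalPoint a ≠ 0 := by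
  intro h
  simpa [h] using sum_sq_sphericalPoint a

theorem det_spherical (a : ℝ × ℝ) :
    Matrix.det (Matrix.of ![sphericalPoint a, sphericalPolar a, sphericalAzimuth a]) =
      Real.sin a.1 := by
  simp only [sphericalPoint, sphericalPolar, sphericalAzimuth, Matrix.det_fin_three,
    Matrix.of_apply, Matrix.cons_val]
  linear_combination
    (Real.sin a.1 ^ 3 + Real.sin a.1 * Real.cos a.1 ^ 2) * Real.sin_sq_add_cos_sq a.2 +
      Real.sin a.1 * Real.sin_sq_add_cos_sq a.1

theorem hasFDerivAt_sphericalPoint (a : ℝ × ℝ) :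
    HasFDerivAt sphericalPoint
      ((ContinuousLinearMap.fst ℝ ℝ ℝ).smulRight (sphericalPolar a) +
        (ContinuousLinearMap.snd ℝ ℝ ℝ).smulRight (sphericalAzimuth a)) a := by
  have h1 : HasFDerivAt (fun x : ℝ × ℝ => x.1) (ContinuousLinearMap.fst ℝ ℝ ℝ) a := hasFDerivAt_fst
  have h2 : HasFDerivAt (fun x : ℝ × ℝ => x.2) (ContinuousLinearMap.snd ℝ ℝ ℝ) a := hasFDerivAt_snd
  rw [hasFDerivAt_pi']
  intro i
  fin_cases i
  · refine (h1.sin.mul h2.cos).congr_fderiv ?_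
    ext <;> simp [sphericalPolar, sphericalAzimuth, mul_comm]
  · refine (h1.sin.mul h2.sin).congr_fderiv ?_
    ext <;> simp [sphericalPolar, sphericalAzimuth, mul_comm]
  · refine h1.cos.congr_fderiv ?_
    ext <;> simp [sphericalPolar, sphericalAzimuth]

theorem hasFDerivAt_sphericalPolar (a : ℝ × ℝ) :
    HasFDerivAt sphericalPolar
      ((ContinuousLinearMap.fst ℝ ℝ ℝ).smulRight (-sphericalPoint a) +
        (ContinuousLinearMap.snd ℝ ℝ ℝ).smulRight (sphericalMixed a)) a := by
  have h1 : HasFDerivAt (fun x : ℝ × ℝ => x.1) (ContinuousLinearMap.fst ℝ ℝ ℝ) a := hasFDerivAt_fst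
  have h2 : HasFDerivAt (fun x : ℝ × ℝ => x.2) (ContinuousLinearMap.snd ℝ ℝ ℝ) a := hasFDerivAt_snd
  rw [hasFDerivAt_pi']
  intro i
  fin_cases i
  · refine (h1.cos.mul h2.cos).congr_fderiv ?_
    ext <;> simp [sphericalPoint, sphericalMixed, mul_comm]
  · refine (h1.cos.mul h2.sin).congr_fderiv ?_
    ext <;> simp [sphericalPoint, sphericalMixed, mul_comm]
  · refine h1.sin.neg.congr_fderiv ?_
    ext <;> simp [sphericalPoint, sphericalMixed]

theorem hasFDerivAt_sphericalAzimuth (a : ℝ × ℝ) :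
    HasFDerivAt sphericalAzimuth
      ((ContinuousLinearMap.fst ℝ ℝ ℝ).smulRight (sphericalMixed a) +
        (ContinuousLinearMap.snd ℝ ℝ ℝ).smulRight
          ![-(Real.sin a.1 * Real.cos a.2), -(Real.sin a.1 * Real.sin a.2), 0]) a := by
  have h1 : HasFDerivAt (fun x : ℝ × ℝ => x.1) (ContinuousLinearMap.fst ℝ ℝ ℝ) a := hasFDerivAt_fst
  have h2 : HasFDerivAt (fun x : ℝ × ℝ => x.2) (ContinuousLinearMap.snd ℝ ℝ ℝ) a := hasFDerivAt_snd
  rw [hasFDerivAt_pi']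
  intro i
  fin_cases i
  · refine (h1.sin.mul h2.sin).neg.congr_fderiv ?_
    ext <;> simp [sphericalMixed, mul_comm]
  · refine (h1.sin.mul h2.cos).congr_fderiv ?_
    ext <;> simp [sphericalMixed, mul_comm]
  · refine (hasFDerivAt_const (0 : ℝ) a).congr_fderiv ?_
    ext <;> simp [sphericalMixed]

/-- The canonical closed 2-form
`ω_p(v, w) = det(p, v, w) / ‖p‖³` on `ℝ³ \ {0}` is not exact: there is no
differentiable 1-form `η : ℝ³ \ {0} → (ℝ³ →L[ℝ] ℝ)` with
`Dη(p)(v)(w) − Dη(p)(w)(v) = ω_p(v, w)` for all `p ≠ 0` and all `v, w`.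
Hence `ω` defines a nonzero class in `H²(ℝ³ \ {0}; ℝ)`. -/
theorem omega_two_form_not_exact :
    ¬ ∃ η : (Fin 3 → ℝ) → ((Fin 3 → ℝ) →L[ℝ] ℝ),
        (∀ p : Fin 3 → ℝ, p ≠ 0 → DifferentiableAt ℝ η p) ∧
        (∀ p : Fin 3 → ℝ, p ≠ 0 → ∀ v w : Fin 3 → ℝ,
          fderiv ℝ η p v w - fderiv ℝ η p w v =
            Matrix.det (Matrix.of ![p, v, w]) / (Real.sqrt (∑ i, p i ^ 2)) ^ 3) := by
  rintro ⟨η, hη, hω⟩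
  have hP (a : ℝ × ℝ) :=
    (hη _ (sphericalPoint_ne_zero a)).hasFDerivAt.comp a (hasFDerivAt_sphericalPoint a)
  have hf (a : ℝ × ℝ) := (hP a).clm_apply (hasFDerivAt_sphericalAzimuth a)
  have hg (a : ℝ × ℝ) := ((hP a).clm_apply (hasFDerivAt_sphericalPolar a)).neg
  have stokes := integral2_divergence_prod_of_hasFDerivAt _ _ _ _
    0 0 Real.pi (2 * Real.pi)
    (fun a _ => (hf a).continuousAt.continuousWithinAt)
    (fun a _ => (hg a).continuousAt.continuousWithinAt)
    (fun a _ => hf a) (fun a _ => hg a)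
  have hω_sphere (a : ℝ × ℝ) :=
    hω _ (sphericalPoint_ne_zero a) (sphericalPolar a) (sphericalAzimuth a)
  simp only [sum_sq_sphericalPoint, det_spherical, Real.sqrt_one, one_pow, div_one] at hω_sphere
  have hdiv (a : ℝ × ℝ) : η (sphericalPoint a) (sphericalMixed a) +
      fderiv ℝ η (sphericalPoint a) (sphericalPolar a) (sphericalAzimuth a) +
      (-fderiv ℝ η (sphericalPoint a) (sphericalAzimuth a) (sphericalPolar a) +
        -η (sphericalPoint a) (sphericalMixed a)) = Real.sin a.1 := by
    rw [← hω_sphere a]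
    ring
  have hint : IntegrableOn (fun a : ℝ × ℝ => Real.sin a.1)
      (Set.uIcc (0, 0) (Real.pi, 2 * Real.pi)) :=
    (Real.continuous_sin.comp continuous_fst).continuousOn.integrableOn_compact isCompact_Icc
  have hpole (y : ℝ) : sphericalAzimuth (0, y) = 0 ∧ sphericalAzimuth (Real.pi, y) = 0 := by
    simp [sphericalAzimuth]
  have hperiod (x : ℝ) : sphericalPoint (x, 2 * Real.pi) = sphericalPoint (x, 0) ∧
      sphericalPolar (x, 2 * Real.pi) = sphericalPolar (x, 0) := by
    simp [sphericalPoint, sphericalPolar]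
  simp [hdiv, hint, hpole, hperiod, Real.pi_ne_zero] at stokes
end

section
/- Let V be a finite set of points in ℝ³ and let T be a finite set of 3-element subsets of V, each affinely independent, such that every point of V belongs to at least one member of T. Let E be the set of 2-element subsets of V that are contained in some member of T, and assume 2·|E| = 3·|T| (as holds when every edge lies in exactly two triangles of a closed triangulated surface). For v ∈ V and t ∈ T with v ∈ t, t = {v, a, b}, let α(v, t) = ∠(a, v, b) be the angle of the triangle t at v. Then Σ_{v ∈ V} (2π − Σ_{t ∈ T, v ∈ t} α(v, t)) = 2π·(|V| − |E| + |T|); i.e. the total exterior 2-angle Σ_ν E₂(ν) equals 2π times the Euler characteristic V − E + F of the triangulated surface, a topological invariant of the immersion. -/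
/-- The angles of a triangle, given as a function on its three vertices, sum to `π`. -/
theorem sum_angle_eq_pi_of_card_eq_three {W P : Type*} [NormedAddCommGroup W]
    [InnerProductSpace ℝ W] [MetricSpace P] [NormedAddTorsor W P] {t : Finset P}
    (ht : t.card = 3) {f : P → ℝ}
    (hf : ∀ v ∈ t, ∀ a ∈ t, ∀ b ∈ t, a ≠ v → b ≠ v → a ≠ b →
      f v = EuclideanGeometry.angle a v b) :
    ∑ v ∈ t, f v = Real.pi := by
  classical
  obtain ⟨x, y, z, hxy, hxz, hyz, rfl⟩ := Finset.card_eq_three.mp ht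
  rw [Finset.sum_insert (by simp [hxy, hxz]), Finset.sum_pair hyz,
    hf x (by simp) z (by simp) y (by simp) hxz.symm hxy.symm hyz.symm,
    hf y (by simp) x (by simp) z (by simp) hxy hyz.symm hxz,
    hf z (by simp) y (by simp) x (by simp) hyz hxz hxy.symm]
  linarith [EuclideanGeometry.angle_add_angle_add_angle_eq_pi z hxy.symm]


open Classical in
/-- polyhedral Gauss–Bonnet: for a triangulated closed surface with
vertex set `V ⊆ ℝ³`, triangle set `T` (3-element affinely independent subsets of `V`
covering `V`), and edge set `E` (the 2-element subsets of `V` contained in some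
triangle), satisfying `2|E| = 3|T|`, the total exterior 2-angle (angle defect)
`Σ_{v ∈ V} (2π − Σ_{t ∋ v} α(v,t))` equals `2π·(|V| − |E| + |T|)`, i.e. `2π` times
the Euler characteristic — a topological invariant of the immersion. -/
theorem total_angle_defect_eq_two_pi_mul_euler_char
    (V : Finset (EuclideanSpace ℝ (Fin 3)))
    (T : Finset (Finset (EuclideanSpace ℝ (Fin 3))))
    (hT : ∀ t ∈ T, t.card = 3 ∧ t ⊆ V ∧
      AffineIndependent ℝ (fun x : {x // x ∈ t} => (x : EuclideanSpace ℝ (Fin 3))))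
    (hcover : ∀ v ∈ V, ∃ t ∈ T, v ∈ t)
    (E : Finset (Finset (EuclideanSpace ℝ (Fin 3))))
    (hE : E = (V.powersetCard 2).filter (fun e => ∃ t ∈ T, e ⊆ t))
    (hclosed : 2 * E.card = 3 * T.card)
    (α : EuclideanSpace ℝ (Fin 3) → Finset (EuclideanSpace ℝ (Fin 3)) → ℝ)
    (hα : ∀ v : EuclideanSpace ℝ (Fin 3), ∀ t ∈ T, v ∈ t →
      ∀ a ∈ t, ∀ b ∈ t, a ≠ v → b ≠ v → a ≠ b →
        α v t = EuclideanGeometry.angle a v b) :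
    ∑ v ∈ V, (2 * Real.pi - ∑ t ∈ T.filter (fun t => v ∈ t), α v t) =
      2 * Real.pi * ((V.card : ℝ) - E.card + T.card) := by
  have hswap : ∑ v ∈ V, ∑ t ∈ T.filter (fun t => v ∈ t), α v t = ∑ t ∈ T, ∑ v ∈ t, α v t := by
    refine Finset.sum_comm' fun v t => ?_
    simp only [Finset.mem_filter]
    exact ⟨fun h => ⟨h.2.2, h.2.1⟩, fun h => ⟨(hT t h.2).2.1 h.1, h.2, h.1⟩⟩
  have hpi : ∑ t ∈ T, ∑ v ∈ t, α v t = T.card * Real.pi := by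
    rw [Finset.sum_congr rfl fun t ht =>
      sum_angle_eq_pi_of_card_eq_three (hT t ht).1 fun v hv => hα v t ht hv]
    simp
  have hclosed' : (2 : ℝ) * E.card = 3 * T.card := mod_cast hclosed
  rw [Finset.sum_sub_distrib, hswap, hpi, Finset.sum_const, nsmul_eq_mul]
  linear_combination Real.pi * hclosed'
end

section
/- Let m ≥ 3 and let v : ZMod m → ℝ² (indices cyclic) be distinct points forming a convex polygon traversed in order: assume that for every j, all points v_i with i ∉ {j, j+1} lie strictly on one and the same open side of the line through v_j and v_{j+1}, and each triple (v_{j−1}, v_j, v_{j+1}) is affinely independent. Then the sum of the exterior angles equals 2π: Σ_j (π − ∠(v_{j−1}, v_j, v_{j+1})) = 2π; equivalently, the sum of the interior angles of the polygon equals (m − 2)·π. -/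
open EuclideanGeometry

/-- Twice the signed area of the triangle with vertices `a`, `b`, `c`. -/
def signedDoubleArea (a b c : EuclideanSpace ℝ (Fin 2)) : ℝ :=
  (b 0 - a 0) * (c 1 - a 1) - (b 1 - a 1) * (c 0 - a 0)

lemma signedDoubleArea_rotate (a b c : EuclideanSpace ℝ (Fin 2)) :
    signedDoubleArea b c a = signedDoubleArea a b c := by
  unfold signedDoubleArea; ring

lemma signedDoubleArea_swap (a b c : EuclideanSpace ℝ (Fin 2)) :
    signedDoubleArea b a c = -signedDoubleArea a b c := by
  unfold signedDoubleArea; ring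

lemma signedDoubleArea_ne_zero_of_notMem {a b x : EuclideanSpace ℝ (Fin 2)} (hab : a ≠ b)
    (hx : x ∉ affineSpan ℝ {a, b}) : signedDoubleArea a b x ≠ 0 := by
  intro h
  unfold signedDoubleArea at h
  have hN : (b 0 - a 0) ^ 2 + (b 1 - a 1) ^ 2 ≠ 0 := by
    intro h0
    apply hab
    ext i
    fin_cases i <;> simp <;> nlinarith [sq_nonneg (b 0 - a 0), sq_nonneg (b 1 - a 1)]
  apply hx
  convert AffineMap.lineMap_mem_affineSpan_pair
    (((b 0 - a 0) * (x 0 - a 0) + (b 1 - a 1) * (x 1 - a 1)) /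
      ((b 0 - a 0) ^ 2 + (b 1 - a 1) ^ 2)) a b using 1
  ext i
  fin_cases i <;> simp [AffineMap.lineMap_apply] <;> field_simp
  · linear_combination (-(b 1 - a 1)) * h
  · linear_combination (b 0 - a 0) * h

lemma signedDoubleArea_mul_pos_of_sSameSide {a b x y : EuclideanSpace ℝ (Fin 2)} (hab : a ≠ b)
    (h : (affineSpan ℝ {a, b}).SSameSide x y) :
    0 < signedDoubleArea a b x * signedDoubleArea a b y := by
  have hCx := signedDoubleArea_ne_zero_of_notMem hab h.left_notMem
  have hCy := signedDoubleArea_ne_zero_of_notMem hab h.right_notMem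
  obtain ⟨⟨p, hp, q, hq, hr⟩, hx, hy⟩ := h
  have hxp : x -ᵥ p ≠ 0 := fun h0 => hx (vsub_eq_zero_iff_eq.1 h0 ▸ hp)
  have hyq : y -ᵥ q ≠ 0 := fun h0 => hy (vsub_eq_zero_iff_eq.1 h0 ▸ hq)
  obtain ⟨r, t, hr, ht, hrt⟩ := hr.exists_pos hxp hyq
  obtain ⟨u, rfl⟩ := mem_affineSpan_pair_iff_exists_lineMap_eq.1 hp
  obtain ⟨w, rfl⟩ := mem_affineSpan_pair_iff_exists_lineMap_eq.1 hq
  have e0 := congrArg (fun f : EuclideanSpace ℝ (Fin 2) => f 0) hrt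
  have e1 := congrArg (fun f : EuclideanSpace ℝ (Fin 2) => f 1) hrt
  simp only [AffineMap.lineMap_apply, vsub_eq_sub, vadd_eq_add, PiLp.smul_apply, PiLp.sub_apply,
    PiLp.add_apply, smul_eq_mul] at e0 e1
  have key : r * signedDoubleArea a b x = t * signedDoubleArea a b y := by
    unfold signedDoubleArea
    linear_combination (b 0 - a 0) * e1 - (b 1 - a 1) * e0
  have hsq : 0 < signedDoubleArea a b x ^ 2 := by positivity
  have : 0 < t * (signedDoubleArea a b x * signedDoubleArea a b y) := by
    have : t * (signedDoubleArea a b x * signedDoubleArea a b y) =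
        r * signedDoubleArea a b x ^ 2 := by
      linear_combination (-signedDoubleArea a b x) * key
    rw [this]; positivity
  exact pos_of_mul_pos_right this ht.le

/-- Additivity of angles at `o`, when `y` lies inside the angle spanned by `x` and `z`. -/
lemma angle_eq_angle_add_angle_of_signedDoubleArea {o x y z : EuclideanSpace ℝ (Fin 2)} (s : ℝ)
    (hxy : 0 < s * signedDoubleArea o x y) (hyz : 0 < s * signedDoubleArea o y z)
    (hxz : 0 < s * signedDoubleArea o x z) : ∠ x o z = ∠ x o y + ∠ y o z := by
  refine InnerProductGeometry.angle_eq_angle_add_add_angle_add_of_mem_span ?_ ?_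
  · rw [vsub_ne_zero]
    rintro rfl
    simp [signedDoubleArea] at hyz
  · have hs : s ≠ 0 := left_ne_zero_of_mul hxz.ne'
    have hA : signedDoubleArea o x z ≠ 0 := right_ne_zero_of_mul hxz.ne'
    obtain ⟨c, hc⟩ : ∃ c : NNReal,
        (c : ℝ) = s * signedDoubleArea o y z / (s * signedDoubleArea o x z) :=
      ⟨⟨_, (div_pos hyz hxz).le⟩, rfl⟩
    obtain ⟨d, hd⟩ : ∃ d : NNReal,
        (d : ℝ) = s * signedDoubleArea o x y / (s * signedDoubleArea o x z) :=
      ⟨⟨_, (div_pos hxy hxz).le⟩, rfl⟩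
    rw [Submodule.mem_span_pair]
    refine ⟨c, d, ?_⟩
    ext i
    simp only [NNReal.smul_def, hc, hd, vsub_eq_sub, PiLp.smul_apply, PiLp.sub_apply,
      PiLp.add_apply, smul_eq_mul]
    rw [mul_div_mul_left _ _ hs, mul_div_mul_left _ _ hs, div_mul_eq_mul_div, div_mul_eq_mul_div,
      ← add_div, div_eq_iff hA]
    unfold signedDoubleArea
    fin_cases i <;> simp <;> ring

/-- The angle sum of the polygon with vertices `p 0, …, p (k + 2)`, where `p 0, …, p (m - 1)` are
the vertices of a convex polygon in order. -/
lemma angle_sum_convex_chain {m : ℕ} {p : ℕ → EuclideanSpace ℝ (Fin 2)} (s : ℝ)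
    (hp : ∀ i < m, i ≠ 0 → p 0 ≠ p i)
    (h : ∀ j i, j + 1 < m → i < m → i ≠ j → i ≠ j + 1 →
      0 < s * signedDoubleArea (p j) (p (j + 1)) (p i)) (k : ℕ) (hk : k + 2 < m) :
    ∠ (p (k + 2)) (p 0) (p 1) + ∑ i ∈ Finset.range (k + 1), ∠ (p i) (p (i + 1)) (p (i + 2)) +
      ∠ (p (k + 1)) (p (k + 2)) (p 0) = (k + 1) * Real.pi := by
  induction k with
  | zero =>
    have := angle_add_angle_add_angle_eq_pi (p 2) (hp 1 (by omega) one_ne_zero)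
    simp only [zero_add, Finset.sum_range_one, Nat.cast_zero, one_mul]
    linarith [angle_comm (p 2) (p 0) (p 1), angle_comm (p 0) (p 1) (p 2),
      angle_comm (p 1) (p 2) (p 0)]
  | succ k ih =>
    have ih := ih (by omega)
    rw [Finset.sum_range_succ]
    have tri := angle_add_angle_add_angle_eq_pi (p (k + 3)) (hp (k + 2) (by omega) (by omega))
    have apex : ∠ (p 1) (p 0) (p (k + 3)) =
        ∠ (p 1) (p 0) (p (k + 2)) + ∠ (p (k + 2)) (p 0) (p (k + 3)) := by
      refine angle_eq_angle_add_angle_of_signedDoubleArea s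
        (h 0 (k + 2) (by omega) (by omega) (by omega) (by omega)) ?_
        (h 0 (k + 3) (by omega) (by omega) (by omega) (by omega))
      rw [← signedDoubleArea_rotate]
      exact h (k + 2) 0 (by omega) (by omega) (by omega) (by omega)
    have side : ∠ (p (k + 1)) (p (k + 2)) (p (k + 3)) =
        ∠ (p (k + 1)) (p (k + 2)) (p 0) + ∠ (p 0) (p (k + 2)) (p (k + 3)) := by
      refine angle_eq_angle_add_angle_of_signedDoubleArea (-s) ?_ ?_ ?_
      · rw [signedDoubleArea_swap, neg_mul_neg]
        exact h (k + 1) 0 (by omega) (by omega) (by omega) (by omega)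
      · rw [signedDoubleArea_swap, ← signedDoubleArea_rotate, neg_mul_neg]
        exact h (k + 2) 0 (by omega) (by omega) (by omega) (by omega)
      · rw [signedDoubleArea_swap, neg_mul_neg]
        exact h (k + 1) (k + 3) (by omega) (by omega) (by omega) (by omega)
    push_cast
    simp only [show k + 1 + 2 = k + 3 from rfl, show k + 1 + 1 = k + 2 from rfl]
    linarith [angle_comm (p (k + 3)) (p 0) (p 1), angle_comm (p (k + 2)) (p 0) (p 1),
      angle_comm (p (k + 2)) (p (k + 3)) (p 0), angle_comm (p 0) (p (k + 2)) (p (k + 3)),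
      angle_comm (p (k + 2)) (p 0) (p (k + 3))]

lemma mul_pos_of_mul_pos_of_mul_pos {a b c : ℝ} (hab : 0 < a * b) (hbc : 0 < b * c) :
    0 < a * c := by
  have h : 0 < b ^ 2 * (a * c) := by
    calc 0 < (a * b) * (b * c) := mul_pos hab hbc
      _ = b ^ 2 * (a * c) := by ring
  exact pos_of_mul_pos_right h (sq_nonneg b)

lemma sum_zmod_eq_sum_range {M : Type*} [AddCommMonoid M] (m : ℕ) [NeZero m] (f : ZMod m → M) :
    ∑ j, f j = ∑ i ∈ Finset.range m, f i := by
  symm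
  refine Finset.sum_bij (fun i _ => (i : ZMod m)) (by simp) ?_ ?_ (by simp)
  · intro i hi j hj h
    rw [ZMod.natCast_eq_natCast_iff', Nat.mod_eq_of_lt (Finset.mem_range.1 hi),
      Nat.mod_eq_of_lt (Finset.mem_range.1 hj)] at h
    exact h
  · intro j _
    exact ⟨j.val, Finset.mem_range.2 j.val_lt, ZMod.natCast_zmod_val j⟩

/-- sum of exterior angles of a convex polygon: let `m ≥ 3` and let
`v : ZMod m → ℝ²` be distinct points forming a convex polygon traversed in order:
for every `j`, all vertices other than `v_j, v_{j+1}` lie strictly on one and the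
same open side of the line through `v_j` and `v_{j+1}`, and each triple
`(v_{j−1}, v_j, v_{j+1})` is affinely independent.  Then the exterior angles sum to
`2π`: `Σⱼ (π − ∠(v_{j−1}, v_j, v_{j+1})) = 2π`; equivalently the interior angles
sum to `(m − 2)·π`. -/
theorem sum_exterior_angles_convex_polygon
    (m : ℕ) [NeZero m] (hm : 3 ≤ m)
    (v : ZMod m → EuclideanSpace ℝ (Fin 2))
    (hinj : Function.Injective v)
    (hconv : ∀ j : ZMod m, ∀ i : ZMod m, i ≠ j → i ≠ j + 1 →
      ∀ i' : ZMod m, i' ≠ j → i' ≠ j + 1 →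
        AffineSubspace.SSameSide (affineSpan ℝ {v j, v (j + 1)}) (v i) (v i'))
    (haff : ∀ j : ZMod m, AffineIndependent ℝ ![v (j - 1), v j, v (j + 1)]) :
    (∑ j : ZMod m, (Real.pi - ∠ (v (j - 1)) (v j) (v (j + 1)))) = 2 * Real.pi ∧
    (∑ j : ZMod m, ∠ (v (j - 1)) (v j) (v (j + 1))) = (m - 2 : ℝ) * Real.pi := by
  obtain ⟨n, rfl⟩ : ∃ n, m = n + 3 := ⟨m - 3, by omega⟩
  have hcast : ∀ i < n + 3, ∀ j < n + 3, i ≠ j → (i : ZMod (n + 3)) ≠ j := by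
    intro i hi j hj hij h
    rw [ZMod.natCast_eq_natCast_iff', Nat.mod_eq_of_lt hi, Nat.mod_eq_of_lt hj] at h
    exact hij h
  have hone : (1 : ZMod (n + 3)) ≠ 0 := mod_cast hcast 1 (by omega) 0 (by omega) one_ne_zero
  have htwo : (2 : ZMod (n + 3)) ≠ 0 := mod_cast hcast 2 (by omega) 0 (by omega) two_ne_zero
  have hpos : ∀ j i i' : ZMod (n + 3), i ≠ j → i ≠ j + 1 → i' ≠ j → i' ≠ j + 1 →
      0 < signedDoubleArea (v j) (v (j + 1)) (v i) * signedDoubleArea (v j) (v (j + 1)) (v i') :=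
    fun j i i' h₁ h₂ h₃ h₄ => signedDoubleArea_mul_pos_of_sSameSide
      (hinj.ne (by simpa using hone)) (hconv j i h₁ h₂ i' h₃ h₄)
  set s := signedDoubleArea (v 0) (v 1) (v 2) with hs
  have hcons : ∀ j : ℕ, 0 < s * signedDoubleArea (v j) (v (j + 1)) (v (j + 2)) := by
    intro j
    induction j with
    | zero =>
      have htwo' : (2 : ZMod (n + 3)) ≠ 0 + 1 := by
        simpa using hcast 2 (by omega) 1 (by omega) (by omega)
      have := hpos 0 2 2 htwo htwo' htwo htwo'
      simpa [hs] using this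
    | succ j ih =>
      have := hpos (j + 1) j (j + 3) (fun h => hone (by linear_combination -h))
        (fun h => htwo (by linear_combination -h)) (fun h => htwo (by linear_combination h))
        (fun h => hone (by linear_combination h))
      rw [add_assoc, one_add_one_eq_two, signedDoubleArea_rotate] at this
      rw [Nat.cast_succ, add_assoc, add_assoc, one_add_one_eq_two,
        show (1 + 2 : ZMod (n + 3)) = 3 by norm_num]
      exact mul_pos_of_mul_pos_of_mul_pos ih this
  have chain := angle_sum_convex_chain (m := n + 3) (p := fun i => v i) s ?_ ?_ n (by omega)
  · have hsum : ∑ j : ZMod (n + 3), ∠ (v (j - 1)) (v j) (v (j + 1)) =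
        ((n + 3 : ℕ) - 2 : ℝ) * Real.pi := by
      have hn : (n : ZMod (n + 3)) + 3 = 0 := mod_cast ZMod.natCast_self (n + 3)
      rw [← Equiv.sum_comp (Equiv.addRight 1), sum_zmod_eq_sum_range, Finset.sum_range_succ,
        Finset.sum_range_succ]
      simp only [Equiv.coe_addRight, add_sub_cancel_right, add_assoc, one_add_one_eq_two]
      rw [show ((n + 1 : ℕ) : ZMod (n + 3)) + 1 = (n + 2 : ℕ) by push_cast; ring,
        show ((n + 1 : ℕ) : ZMod (n + 3)) + 2 = 0 by push_cast; linear_combination hn,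
        show ((n + 2 : ℕ) : ZMod (n + 3)) + 1 = 0 by push_cast; linear_combination hn,
        show ((n + 2 : ℕ) : ZMod (n + 3)) + 2 = 1 by push_cast; linear_combination hn]
      push_cast at chain ⊢
      linarith
    refine ⟨?_, hsum⟩
    rw [Finset.sum_sub_distrib, hsum]
    simp [ZMod.card]
    ring
  · intro i hi h0
    exact hinj.ne (hcast 0 (by omega) i hi h0.symm)
  · intro j i hj hi h₁ h₂
    push_cast
    refine mul_pos_of_mul_pos_of_mul_pos (hcons j) (hpos j (j + 2) i
      (fun h => htwo (by linear_combination h)) (fun h => hone (by linear_combination h))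
      (hcast i hi j (by omega) h₁) ?_)
    exact_mod_cast hcast i hi (j + 1) hj h₂
end
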